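/- arXiv:2312.02393 — 2 statements merged into one kernel-verified Lean document; each statement's English description precedes it below -/
import Mathlib

section
/- Injectivity of the Radon transform: if f ∈ L¹(ℝ²) satisfies Rf(t,θ) = 0 for almost all (t,θ) ∈ ℝ × [0,π), then f = 0 almost everywhere. -/
open MeasureTheory Real

/-- The rotation of the plane by the angle `θ` preserves Lebesgue measure. -/
lemma measurePreserving_rotation (θ : ℝ) :
    MeasurePreserving (fun p : ℝ × ℝ ↦
      (p.1 * cos θ - p.2 * sin θ, p.1 * sin θ + p.2 * cos θ)) := by
  let M : ℝ × ℝ →ₗ[ℝ] ℝ × ℝ :=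
    Matrix.toLin (.finTwoProd ℝ) (.finTwoProd ℝ) !![cos θ, -sin θ; sin θ, cos θ]
  have hM : (fun p : ℝ × ℝ ↦ (p.1 * cos θ - p.2 * sin θ, p.1 * sin θ + p.2 * cos θ)) = M := by
    funext p
    simp only [M, Matrix.toLin_finTwoProd_apply, Prod.mk.injEq]
    constructor <;> ring
  have hdet : LinearMap.det M = 1 := by
    rw [LinearMap.det_toLin, Matrix.det_fin_two_of, ← cos_sq_add_sin_sq θ]
    ring
  refine ⟨by fun_prop, ?_⟩
  rw [hM, Measure.volume_eq_prod,
    Measure.map_linearMap_addHaar_eq_smul_addHaar _ (by simp [hdet]), hdet]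
  simp

lemma integrable_mul_cexp {f : ℝ × ℝ → ℝ} (hf : Integrable f) {φ : ℝ × ℝ → ℝ}
    (hφ : Continuous φ) :
    Integrable (fun v ↦ (f v : ℂ) * Complex.exp (φ v * Complex.I)) :=
  hf.ofReal.mul_bdd (c := 1) (by fun_prop : Continuous _).aestronglyMeasurable
    (.of_forall fun v ↦ (Complex.norm_exp_ofReal_mul_I _).le)

/-- The Fourier slice theorem, in the case of a vanishing Radon transform. -/
lemma integral_mul_cexp_eq_zero_of_radon_eq_zero {f : ℝ × ℝ → ℝ} (hf : Integrable f) {θ : ℝ}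
    (h : ∀ᵐ t : ℝ, (∫ s : ℝ, f (t * cos θ - s * sin θ, t * sin θ + s * cos θ)) = 0) (r : ℝ) :
    ∫ v : ℝ × ℝ, (f v : ℂ) *
      Complex.exp ((r * (cos θ * v.1 + sin θ * v.2) : ℝ) * Complex.I) = 0 := by
  have hR := measurePreserving_rotation θ
  have hint := integrable_mul_cexp hf (φ := fun v ↦ r * (cos θ * v.1 + sin θ * v.2))
    (by fun_prop)
  have hmeas := hint.aestronglyMeasurable
  rw [← hR.map_eq] at hmeas
  have key : ∀ t s : ℝ, r * (cos θ * (t * cos θ - s * sin θ) +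
      sin θ * (t * sin θ + s * cos θ)) = r * t := fun t s ↦ by
    linear_combination r * t * cos_sq_add_sin_sq θ
  have hcomp := hR.integrable_comp_of_integrable hint
  rw [← hR.map_eq, integral_map hR.aemeasurable hmeas, Measure.volume_eq_prod]
  refine (integral_prod _ hcomp).trans ?_
  refine integral_eq_zero_of_ae ?_
  filter_upwards [h] with t ht
  simp only [Function.comp_apply, key, Pi.zero_apply]
  rw [integral_mul_const, integral_complex_ofReal, ht]
  simp

lemma continuous_integral_mul_cexp {f : ℝ × ℝ → ℝ} (hf : Integrable f) (r : ℝ) :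
    Continuous fun θ : ℝ ↦ ∫ v : ℝ × ℝ, (f v : ℂ) *
      Complex.exp ((r * (cos θ * v.1 + sin θ * v.2) : ℝ) * Complex.I) := by
  refine continuous_of_dominated (bound := fun v ↦ ‖f v‖)
    (fun θ ↦ (integrable_mul_cexp hf (by fun_prop)).aestronglyMeasurable)
    (fun θ ↦ .of_forall fun v ↦ ?_) hf.norm (.of_forall fun v ↦ by fun_prop)
  rw [norm_mul, Complex.norm_exp_ofReal_mul_I, mul_one, Complex.norm_real]

/-- Polar coordinates with a signed radius and an angle in `[0, π)`. -/
lemma exists_signed_polar (a b : ℝ) :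
    ∃ r : ℝ, ∃ θ ∈ Set.Ico 0 π, a = r * cos θ ∧ b = r * sin θ := by
  set z : ℂ := ⟨a, b⟩
  have ha : a = ‖z‖ * cos z.arg := (Complex.norm_mul_cos_arg z).symm
  have hb : b = ‖z‖ * sin z.arg := (Complex.norm_mul_sin_arg z).symm
  have h1 := Complex.neg_pi_lt_arg z
  have h2 := Complex.arg_le_pi z
  rcases lt_or_ge z.arg 0 with h0 | h0
  · exact ⟨-‖z‖, z.arg + π, ⟨by linarith, by linarith⟩, by simp [← ha], by simp [← hb]⟩
  · rcases h2.lt_or_eq with h3 | h3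
    · exact ⟨‖z‖, z.arg, ⟨h0, h3⟩, ha, hb⟩
    · rw [h3] at ha hb
      exact ⟨-‖z‖, 0, ⟨le_rfl, pi_pos⟩, by simpa using ha, by simpa using hb⟩

/-- An integrable function on the plane is determined by its Fourier transform. -/
lemma ae_eq_zero_of_integral_mul_cexp_eq_zero {f : ℝ × ℝ → ℝ} (hf : Integrable f)
    (h : ∀ a b : ℝ, ∫ v : ℝ × ℝ, (f v : ℂ) *
      Complex.exp ((a * v.1 + b * v.2 : ℝ) * Complex.I) = 0) :
    f =ᵐ[volume] 0 := by
  have hm : AEMeasurable (fun v ↦ ENNReal.ofReal (f v)) := hf.aemeasurable.ennreal_ofReal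
  have hm' : AEMeasurable (fun v ↦ ENNReal.ofReal (-f v)) := hf.neg.aemeasurable.ennreal_ofReal
  have := isFiniteMeasure_withDensity_ofReal hf.hasFiniteIntegral
  have : IsFiniteMeasure (volume.withDensity fun v ↦ ENNReal.ofReal (-f v)) :=
    isFiniteMeasure_withDensity_ofReal hf.neg.hasFiniteIntegral
  have heq : (volume.withDensity fun v ↦ ENNReal.ofReal (f v)) =
      volume.withDensity fun v ↦ ENNReal.ofReal (-f v) := by
    refine Measure.ext_of_charFunDual (funext fun L ↦ ?_)
    have hL : ∀ v : ℝ × ℝ, L v = L (1, 0) * v.1 + L (0, 1) * v.2 := fun v ↦ by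
      have hv : v = v.1 • ((1, 0) : ℝ × ℝ) + v.2 • ((0, 1) : ℝ × ℝ) := by ext <;> simp
      conv_lhs => rw [hv]
      simp only [map_add, map_smul, smul_eq_mul]
      ring
    simp only [charFunDual_apply]
    rw [integral_withDensity_eq_integral_toReal_smul₀ hm (by simp),
      integral_withDensity_eq_integral_toReal_smul₀ hm' (by simp), ← sub_eq_zero,
      ← integral_sub, ← h (L (1, 0)) (L (0, 1))]
    · refine integral_congr_ae (.of_forall fun v ↦ ?_)
      simp only [← hL, ENNReal.toReal_ofReal', Complex.real_smul]
      rw [← sub_mul, ← Complex.ofReal_sub, max_zero_sub_eq_self]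
    · simp only [ENNReal.toReal_ofReal', Complex.real_smul]
      exact integrable_mul_cexp hf.pos_part L.continuous
    · simp only [ENNReal.toReal_ofReal', Complex.real_smul]
      exact integrable_mul_cexp hf.neg_part L.continuous
  filter_upwards [(withDensity_eq_iff_of_sigmaFinite hm hm').1 heq] with v hv
  rcases le_total (f v) 0 with h0 | h0
  · rw [ENNReal.ofReal_of_nonpos h0, eq_comm, ENNReal.ofReal_eq_zero] at hv
    exact le_antisymm h0 (neg_nonpos.1 hv)
  · rw [ENNReal.ofReal_of_nonpos (neg_nonpos.2 h0), ENNReal.ofReal_eq_zero] at hv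
    exact le_antisymm hv h0

/-- Injectivity of the Radon transform: if `f ∈ L¹(ℝ²)` satisfies `Rf(t,θ) = 0` for almost
all `(t,θ) ∈ ℝ × [0,π)`, then `f = 0` almost everywhere. -/
theorem statement12 (f : ℝ × ℝ → ℝ) (hf : Integrable f)
    (h : ∀ᵐ p : ℝ × ℝ ∂(volume.restrict (Set.univ ×ˢ Set.Ico 0 Real.pi)),
      (∫ s : ℝ, f (p.1 * Real.cos p.2 - s * Real.sin p.2,
        p.1 * Real.sin p.2 + s * Real.cos p.2)) = 0) :
    f =ᵐ[volume] 0 := by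
  rw [Measure.volume_eq_prod, ← Measure.prod_restrict, Measure.restrict_univ,
    ← Measure.prod_swap] at h
  have hslice := Measure.ae_ae_of_ae_prod (ae_of_ae_map measurable_swap.aemeasurable h)
  refine ae_eq_zero_of_integral_mul_cexp_eq_zero hf fun a b ↦ ?_
  obtain ⟨r, θ, hθ, rfl, rfl⟩ := exists_signed_polar a b
  have hzero := Measure.eqOn_Ico_of_ae_eq (μ := volume)
    (hslice.mono fun θ hθ ↦ integral_mul_cexp_eq_zero_of_radon_eq_zero hf hθ r)
    (continuous_integral_mul_cexp hf r).continuousOn continuousOn_const hθ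
  simpa only [mul_add, mul_assoc] using hzero
end

section
/- Sobolev continuity of the Radon transform: let Ω ⊂ ℝ² be open and bounded, α ∈ ℝ, and f ∈ L¹(ℝ²) ∩ H₀^α(Ω). Then Rf ∈ H^{α+1/2}(ℝ × [0,π)) and there is a constant C_α > 1 (independent of f) such that ‖f‖_{H^α(ℝ²)} ≤ ‖Rf‖_{H^{α+1/2}(ℝ × [0,π))} ≤ C_α · ‖f‖_{H^α(ℝ²)}. -/
open MeasureTheory Real

/-- The two-dimensional Fourier transform, with kernel `exp (-i p·w)`. -/
noncomputable def planeFourier (f : ℝ × ℝ → ℝ) (w : ℝ × ℝ) : ℂ :=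
  ∫ p : ℝ × ℝ, (f p : ℂ) * Complex.exp (-Complex.I * (p.1 * w.1 + p.2 * w.2))

lemma norm_fourier_kernel (a : ℝ) : ‖Complex.exp (-Complex.I * a)‖ = 1 := by
  rw [show -Complex.I * (a : ℂ) = ((-a : ℝ) : ℂ) * Complex.I by push_cast; ring]
  exact Complex.norm_exp_ofReal_mul_I _

lemma norm_planeFourier_kernel (p w : ℝ × ℝ) :
    ‖Complex.exp (-Complex.I * (p.1 * w.1 + p.2 * w.2))‖ = 1 := by
  have := norm_fourier_kernel (p.1 * w.1 + p.2 * w.2)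
  push_cast at this
  exact this

lemma continuous_planeFourier {f : ℝ × ℝ → ℝ} (hf : Integrable f) :
    Continuous (planeFourier f) := by
  refine continuous_of_dominated (bound := fun p => ‖f p‖) ?_ ?_ hf.norm ?_
  · intro w
    exact hf.ofReal.aestronglyMeasurable.mul (by fun_prop)
  · intro w
    refine Filter.Eventually.of_forall fun p => ?_
    rw [norm_mul, norm_planeFourier_kernel, mul_one, Complex.norm_real]
  · exact Filter.Eventually.of_forall fun p => by fun_prop

/-- Rotation of the plane by the angle `θ`. -/
noncomputable def planeRotation (θ : ℝ) (q : ℝ × ℝ) : ℝ × ℝ :=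
  (q.1 * cos θ - q.2 * sin θ, q.1 * sin θ + q.2 * cos θ)

lemma measurePreserving_planeRotation (θ : ℝ) :
    MeasurePreserving (planeRotation θ) := by
  have hdet : LinearMap.det (Matrix.toLin (.finTwoProd ℝ) (.finTwoProd ℝ)
      !![cos θ, -sin θ; sin θ, cos θ]) = 1 := by
    rw [LinearMap.det_toLin, Matrix.det_fin_two_of]
    linear_combination sin_sq_add_cos_sq θ
  have hrot : planeRotation θ = Matrix.toLin (.finTwoProd ℝ) (.finTwoProd ℝ)
      !![cos θ, -sin θ; sin θ, cos θ] := by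
    ext q <;> simp [planeRotation, Matrix.toLin_finTwoProd_apply] <;> ring
  refine ⟨by unfold planeRotation; fun_prop, ?_⟩
  rw [hrot, Measure.map_linearMap_addHaar_eq_smul_addHaar _ (by rw [hdet]; exact one_ne_zero),
    hdet]
  simp

/-- The Fourier slice theorem in the plane. -/
lemma fourier_radon_eq_planeFourier {f : ℝ × ℝ → ℝ} (hf : Integrable f) (S θ : ℝ) :
    ∫ t : ℝ, (↑(∫ s : ℝ, f (t * cos θ - s * sin θ, t * sin θ + s * cos θ)) : ℂ) *
      Complex.exp (-Complex.I * (S * t)) = planeFourier f (S * cos θ, S * sin θ) := by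
  set G : ℝ × ℝ → ℂ := fun p =>
    (f p : ℂ) * Complex.exp (-Complex.I * (p.1 * (S * cos θ : ℝ) + p.2 * (S * sin θ : ℝ)))
    with hG
  have hGi : Integrable G := by
    refine hf.mono (hf.ofReal.aestronglyMeasurable.mul (by fun_prop)) ?_
    refine Filter.Eventually.of_forall fun p => ?_
    rw [hG]
    simp only [norm_mul]
    rw [norm_planeFourier_kernel p (S * cos θ, S * sin θ), mul_one,
      Complex.norm_real]
  have hmp := measurePreserving_planeRotation θ
  have hGr : Integrable (G ∘ planeRotation θ) := hmp.integrable_comp_of_integrable hGi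
  have h1 : planeFourier f (S * cos θ, S * sin θ) = ∫ q, G (planeRotation θ q) := by
    rw [← integral_map hmp.measurable.aemeasurable
      (by rw [hmp.map_eq]; exact hGi.aestronglyMeasurable), hmp.map_eq]
    rfl
  rw [h1, Measure.volume_eq_prod, integral_prod _ (by exact hGr)]
  refine integral_congr_ae (Filter.Eventually.of_forall fun t => ?_)
  simp only
  rw [← integral_complex_ofReal, ← integral_mul_const]
  refine integral_congr_ae (Filter.Eventually.of_forall fun s => ?_)
  simp only [hG, planeRotation]
  congr 3
  push_cast
  have := Complex.sin_sq_add_cos_sq (θ : ℂ)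
  linear_combination (-(S : ℂ) * t) * this

/-- Polar coordinates with a signed radius. -/
lemma lintegral_signed_polar {h : ℝ × ℝ → ENNReal} (hh : Measurable h) :
    ∫⁻ q in Set.univ ×ˢ Set.Ico 0 π, h (q.1 * cos q.2, q.1 * sin q.2) =
      ∫⁻ w : ℝ × ℝ, h w * ENNReal.ofReal (√(w.1 ^ 2 + w.2 ^ 2))⁻¹ := by
  set g : ℝ × ℝ → ENNReal := fun q => h (q.1 * cos q.2, q.1 * sin q.2) with hg
  have hgm : Measurable g := hh.comp (by fun_prop)
  have hrhs : ∫⁻ w : ℝ × ℝ, h w * ENNReal.ofReal (√(w.1 ^ 2 + w.2 ^ 2))⁻¹ =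
      ∫⁻ q in Set.Ioi 0 ×ˢ Set.Ioo (-π) π, g q := by
    rw [← lintegral_comp_polarCoord_symm]
    refine setLIntegral_congr_fun (measurableSet_Ioi.prod measurableSet_Ioo) fun q hq => ?_
    have hq1 : 0 < q.1 := hq.1
    have hs : √((q.1 * cos q.2) ^ 2 + (q.1 * sin q.2) ^ 2) = q.1 := by
      rw [show (q.1 * cos q.2) ^ 2 + (q.1 * sin q.2) ^ 2 = q.1 ^ 2 by
        linear_combination q.1 ^ 2 * sin_sq_add_cos_sq q.2, sqrt_sq hq1.le]
    simp only [polarCoord_symm_apply, hs, hg, smul_eq_mul]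
    rw [mul_left_comm, ← ENNReal.ofReal_mul hq1.le, mul_inv_cancel₀ hq1.ne', ENNReal.ofReal_one,
      mul_one]
  have hnull : ∫⁻ q in Set.univ ×ˢ Set.Ico 0 π, g q =
      ∫⁻ q in (Set.Ioi 0 ∪ Set.Iio 0) ×ˢ Set.Ioo 0 π, g q := by
    rw [Measure.volume_eq_prod]
    refine setLIntegral_congr (Measure.set_prod_ae_eq ?_ Ioo_ae_eq_Ico.symm)
    rw [Set.union_comm, Set.Iio_union_Ioi]
    exact (ae_eq_univ.mpr (by simp)).symm
  have hnull' : ∫⁻ q in Set.Ioi 0 ×ˢ Set.Ioo (-π) π, g q =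
      ∫⁻ q in Set.Ioi 0 ×ˢ (Set.Ioo 0 π ∪ Set.Ioo (-π) 0), g q := by
    rw [Measure.volume_eq_prod]
    refine setLIntegral_congr (Measure.set_prod_ae_eq (ae_eq_refl _) ?_)
    have : Set.Ioo (-π) π = Set.Ioo (-π) 0 ∪ Set.Ico 0 π :=
      (Set.Ioo_union_Ico_eq_Ioo (by linarith [pi_pos]) pi_pos.le).symm
    rw [this, Set.union_comm]
    exact (Ioo_ae_eq_Ico.symm).union (ae_eq_refl _)
  have hflip : ∫⁻ q in Set.Iio 0 ×ˢ Set.Ioo 0 π, g q =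
      ∫⁻ q in Set.Ioi 0 ×ˢ Set.Ioo (-π) 0, g q := by
    have hmp : MeasurePreserving (fun q : ℝ × ℝ => (-q.1, q.2 + π)) := by
      rw [Measure.volume_eq_prod]
      exact (Measure.measurePreserving_neg (volume : Measure ℝ)).prod
        (measurePreserving_add_right volume π)
    rw [← hmp.setLIntegral_comp_preimage (measurableSet_Iio.prod measurableSet_Ioo) hgm]
    have : (fun q : ℝ × ℝ => (-q.1, q.2 + π)) ⁻¹' (Set.Iio 0 ×ˢ Set.Ioo 0 π) =
        Set.Ioi 0 ×ˢ Set.Ioo (-π) 0 := by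
      ext q
      simp only [Set.mem_preimage, Set.mem_prod, Set.mem_Iio, Set.mem_Ioi, Set.mem_Ioo]
      constructor <;> rintro ⟨h1, h2, h3⟩ <;> exact ⟨by linarith, by linarith, by linarith⟩
    rw [this]
    simp [hg]
  rw [hrhs, hnull, hnull', Set.union_prod, Set.prod_union,
    lintegral_union (measurableSet_Iio.prod measurableSet_Ioo),
    lintegral_union (measurableSet_Ioi.prod measurableSet_Ioo), hflip]
  · refine Set.disjoint_left.mpr fun q hq hq' => ?_
    exact absurd hq.2.1 (not_lt.mpr hq'.2.2.le)
  · refine Set.disjoint_left.mpr fun q hq hq' => ?_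
    have h1 : 0 < q.1 := hq.1
    have h2 : q.1 < 0 := hq'.1
    linarith

open scoped SchwartzMap FourierTransform in
/-- The Fourier transform of a function supported in a fixed bounded set reproduces itself under
integration against a fixed Schwartz function. -/
lemma exists_schwartz_reproducing {B : Set (ℝ × ℝ)} (hB : Bornology.IsBounded B) :
    ∃ g : 𝓢(ℂ, ℂ), ∀ f : ℝ × ℝ → ℝ, Integrable f → Function.support f ⊆ B → ∀ w : ℝ × ℝ,
      planeFourier f w =
        ∫ η : ℂ, planeFourier f (2 * π * η.re + w.1, 2 * π * η.im + w.2) * g η := by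
  obtain ⟨R, hR, hBR⟩ := hB.exists_pos_norm_le
  let χ : ContDiffBump (0 : ℂ) := ⟨2 * R, 2 * R + 1, by positivity, by linarith⟩
  have hχc : HasCompactSupport fun z : ℂ => (χ z : ℂ) :=
    χ.hasCompactSupport.comp_left (g := fun x : ℝ => (x : ℂ)) Complex.ofReal_zero
  have hχs : ContDiff ℝ (⊤ : ℕ∞) fun z : ℂ => (χ z : ℂ) :=
    Complex.ofRealCLM.contDiff.comp χ.contDiff
  refine ⟨𝓕⁻ (hχc.toSchwartzMap hχs), fun f hf hsupp w => ?_⟩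
  set g : 𝓢(ℂ, ℂ) := 𝓕⁻ (hχc.toSchwartzMap hχs) with hg
  have hFg : ∀ z, 𝓕 (g : ℂ → ℂ) z = χ z := fun z => by
    rw [← SchwartzMap.fourier_coe, hg, FourierTransform.fourier_fourierInv_eq]
    rfl
  have hmp := Complex.volume_preserving_equiv_real_prod
  set fw : ℂ → ℂ := fun z =>
    (f (z.re, z.im) : ℂ) * Complex.exp (-Complex.I * (z.re * w.1 + z.im * w.2)) with hfw
  have hfc : Integrable fun z : ℂ => f (z.re, z.im) := hmp.integrable_comp_of_integrable hf
  have hfwi : Integrable fw := by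
    refine hfc.mono (hfc.ofReal.aestronglyMeasurable.mul (by fun_prop)) ?_
    refine Filter.Eventually.of_forall fun z => ?_
    rw [hfw]
    simp only [norm_mul]
    rw [norm_planeFourier_kernel (z.re, z.im) w, mul_one, Complex.norm_real]
  have hFfw : ∀ η : ℂ,
      𝓕 fw η = planeFourier f (2 * π * η.re + w.1, 2 * π * η.im + w.2) := fun η => by
    rw [Real.fourier_eq', planeFourier,
      ← hmp.integral_comp Complex.measurableEquivRealProd.measurableEmbedding]
    refine integral_congr_ae (Filter.Eventually.of_forall fun z => ?_)
    simp only [hfw, smul_eq_mul, Complex.measurableEquivRealProd_apply, Complex.inner]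
    rw [mul_left_comm, ← Complex.exp_add]
    congr 2
    simp
    ring
  have hflip : ∫ η, 𝓕 fw η * g η = ∫ z, fw z * 𝓕 (g : ℂ → ℂ) z := by
    simpa using! VectorFourier.integral_fourierIntegral_smul_eq_flip (L := innerₗ ℂ)
      Real.continuous_fourierChar continuous_inner hfwi g.integrable
  simp_rw [← hFfw]
  rw [hflip, planeFourier,
    ← hmp.integral_comp Complex.measurableEquivRealProd.measurableEmbedding]
  refine integral_congr_ae (Filter.Eventually.of_forall fun z => ?_)
  simp only [hFg, Complex.measurableEquivRealProd_apply, hfw]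
  by_cases hz : f (z.re, z.im) = 0
  · simp [hz]
  · have hzB := hBR _ (hsupp hz)
    have h1 : |z.re| ≤ R := (norm_fst_le (z.re, z.im)).trans hzB
    have h2 : |z.im| ≤ R := (norm_snd_le (z.re, z.im)).trans hzB
    have hχz : χ z = 1 := χ.one_of_mem_closedBall (by
      rw [mem_closedBall_zero_iff]
      exact (Complex.norm_le_abs_re_add_abs_im z).trans (by change _ ≤ 2 * R; linarith))
    simp [hχz]

lemma sq_lintegral_mul_le {X : Type*} [MeasurableSpace X] {μ : Measure X} {u v : X → ENNReal}
    (hu : AEMeasurable u μ) (hv : AEMeasurable v μ) :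
    (∫⁻ x, u x * v x ∂μ) ^ 2 ≤ (∫⁻ x, u x ^ 2 ∂μ) * ∫⁻ x, v x ^ 2 ∂μ := by
  have h := ENNReal.lintegral_mul_le_Lp_mul_Lq μ Real.HolderConjugate.two_two hu hv
  have hsq : ∀ a : ENNReal, (a ^ (1 / 2 : ℝ)) ^ 2 = a := fun a => by
    rw [← ENNReal.rpow_natCast, ← ENNReal.rpow_mul]
    norm_num
  calc (∫⁻ x, u x * v x ∂μ) ^ 2 ≤ _ := pow_le_pow_left' h 2
    _ = _ := by
      rw [mul_pow, hsq, hsq]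
      simp only [ENNReal.rpow_two]

open scoped SchwartzMap in
lemma lintegral_schwartz_sq_mul_lt_top (g : 𝓢(ℂ, ℂ)) (k : ℕ) :
    ∫⁻ η, ENNReal.ofReal ((1 + ‖η‖) ^ (2 * k)) * ‖g η‖ₑ ^ 2 < ⊤ := by
  obtain ⟨D, hD⟩ : ∃ D : ℝ, ∀ η, (1 + ‖η‖) ^ (k + 2) * ‖g η‖ ≤ D := ⟨_, fun η => by
    simpa using SchwartzMap.one_add_le_sup_seminorm_apply (𝕜 := ℝ) (m := (k + 2, 0)) le_rfl le_rfl
      g η⟩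
  have hint : Integrable fun η : ℂ => D ^ 2 * (1 + ‖η‖) ^ (-4 : ℝ) :=
    (integrable_one_add_norm (by rw [Complex.finrank_real_complex]; norm_num)).const_mul _
  refine lt_of_le_of_lt (lintegral_mono fun η => ?_) hint.lintegral_lt_top
  rw [← ofReal_norm, ← ENNReal.ofReal_pow (norm_nonneg _),
    ← ENNReal.ofReal_mul (by positivity)]
  refine ENNReal.ofReal_le_ofReal ?_
  have hpos : 0 < 1 + ‖η‖ := by positivity
  rw [rpow_neg hpos.le, show (4 : ℝ) = ((4 : ℕ) : ℝ) by norm_num, rpow_natCast,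
    ← div_eq_mul_inv, le_div_iff₀ (by positivity)]
  calc (1 + ‖η‖) ^ (2 * k) * ‖g η‖ ^ 2 * (1 + ‖η‖) ^ 4
      = ((1 + ‖η‖) ^ (k + 2) * ‖g η‖) ^ 2 := by ring
    _ ≤ D ^ 2 := pow_le_pow_left₀ (by positivity) (hD η) 2

lemma lintegral_comp_dilation_translation {h : ℝ × ℝ → ENNReal} (hh : Measurable h)
    (w : ℝ × ℝ) :
    ∫⁻ η : ℂ, h (2 * π * η.re + w.1, 2 * π * η.im + w.2) =
      ENNReal.ofReal |((2 * π) ^ 2)⁻¹| * ∫⁻ v, h v := by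
  have hmp := Complex.volume_preserving_equiv_real_prod
  have h1 : ∫⁻ η : ℂ, h (2 * π * η.re + w.1, 2 * π * η.im + w.2) =
      ∫⁻ v : ℝ × ℝ, h ((2 * π) • v + w) := by
    rw [← hmp.lintegral_comp_emb Complex.measurableEquivRealProd.measurableEmbedding]
    rfl
  have h2 : ∫⁻ v : ℝ × ℝ, h ((2 * π) • v + w) =
      ∫⁻ v, h (v + w) ∂(Measure.map ((2 * π) • ·) volume) := by
    rw [lintegral_map (f := fun v => h (v + w)) (hh.comp (measurable_add_const w))
      (measurable_const_smul _)]
  rw [h1, h2, Measure.map_addHaar_smul _ (by positivity), lintegral_smul_measure,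
    lintegral_add_right_eq_self h w]
  simp

/-- The Fourier transform of a function supported in a fixed bounded set is controlled on the unit
disc by the Sobolev norm. -/
lemma exists_enorm_planeFourier_sq_le {B : Set (ℝ × ℝ)} (hB : Bornology.IsBounded B) (α : ℝ) :
    ∃ K : ENNReal, K < ⊤ ∧ ∀ f : ℝ × ℝ → ℝ, Integrable f → Function.support f ⊆ B →
      ∀ w : ℝ × ℝ, w.1 ^ 2 + w.2 ^ 2 ≤ 1 → ‖planeFourier f w‖ₑ ^ 2 ≤
        K * ∫⁻ v : ℝ × ℝ,
          ENNReal.ofReal ((1 + v.1 ^ 2 + v.2 ^ 2) ^ α) * ‖planeFourier f v‖ₑ ^ 2 := by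
  obtain ⟨g, hg⟩ := exists_schwartz_reproducing hB
  obtain ⟨k, hk⟩ := exists_nat_ge |α|
  refine ⟨ENNReal.ofReal (10 ^ (2 * k)) *
    (∫⁻ η, ENNReal.ofReal ((1 + ‖η‖) ^ (2 * k)) * ‖g η‖ₑ ^ 2) *
      ENNReal.ofReal |((2 * π) ^ 2)⁻¹|, ?_, fun f hf hsupp w hw => ?_⟩
  · exact ENNReal.mul_lt_top (ENNReal.mul_lt_top ENNReal.ofReal_lt_top
      (lintegral_schwartz_sq_mul_lt_top g k)) ENNReal.ofReal_lt_top
  have hcont := continuous_planeFourier hf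
  let a : ℂ → ℝ × ℝ := fun η => (2 * π * η.re + w.1, 2 * π * η.im + w.2)
  have ha : Continuous a := by fun_prop
  let b : ℂ → ℝ := fun η => 1 + (a η).1 ^ 2 + (a η).2 ^ 2
  have hb1 : ∀ η, 1 ≤ b η := fun η => by
    have := sq_nonneg (a η).1
    have := sq_nonneg (a η).2
    simp only [b]; linarith
  have hb0 : ∀ η, 0 < b η := fun η => one_pos.trans_le (hb1 η)
  have hbm : Measurable b := by
    have : Continuous b := by fun_prop
    exact this.measurable
  have hble : ∀ η, b η ≤ (10 * (1 + ‖η‖)) ^ 2 := fun η => by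
    have hn : η.re ^ 2 + η.im ^ 2 = ‖η‖ ^ 2 := by
      rw [Complex.sq_norm, Complex.normSq_apply]; ring
    have hπ : π ^ 2 ≤ 10 := by nlinarith [pi_lt_d2, pi_pos]
    have h1 : (2 * π * η.re + w.1) ^ 2 ≤ 2 * (4 * π ^ 2 * η.re ^ 2 + w.1 ^ 2) := by
      nlinarith [sq_nonneg (2 * π * η.re - w.1)]
    have h2 : (2 * π * η.im + w.2) ^ 2 ≤ 2 * (4 * π ^ 2 * η.im ^ 2 + w.2 ^ 2) := by
      nlinarith [sq_nonneg (2 * π * η.im - w.2)]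
    have h3 : π ^ 2 * ‖η‖ ^ 2 ≤ 10 * ‖η‖ ^ 2 :=
      mul_le_mul_of_nonneg_right hπ (sq_nonneg _)
    simp only [b, a]
    nlinarith [norm_nonneg η]
  have hsplit : ∀ η, ‖planeFourier f (a η) * g η‖ₑ =
      (ENNReal.ofReal (b η ^ (α / 2)) * ‖planeFourier f (a η)‖ₑ) *
        (ENNReal.ofReal (b η ^ (-α / 2)) * ‖g η‖ₑ) := fun η => by
    rw [mul_mul_mul_comm, ← ENNReal.ofReal_mul (rpow_nonneg (hb0 η).le _), ← rpow_add (hb0 η),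
      enorm_mul]
    ring_nf
    simp
  have hsq : ∀ (η : ℂ) (s : ℝ), ENNReal.ofReal (b η ^ (s / 2)) ^ 2 = ENNReal.ofReal (b η ^ s) :=
    fun η s => by
      rw [← ENNReal.ofReal_pow (rpow_nonneg (hb0 η).le _), ← rpow_natCast, ← rpow_mul (hb0 η).le]
      norm_num
  have hweight : ∀ η, b η ^ (-α) ≤ 10 ^ (2 * k) * (1 + ‖η‖) ^ (2 * k) := fun η => by
    calc b η ^ (-α) ≤ b η ^ (k : ℝ) :=
          rpow_le_rpow_of_exponent_le (hb1 η) ((neg_le_abs α).trans hk)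
      _ = b η ^ k := rpow_natCast _ _
      _ ≤ ((10 * (1 + ‖η‖)) ^ 2) ^ k := pow_le_pow_left₀ (hb0 η).le (hble η) k
      _ = _ := by rw [← pow_mul, mul_pow]
  have hum : Measurable fun η => ENNReal.ofReal (b η ^ (α / 2)) * ‖planeFourier f (a η)‖ₑ :=
    (hbm.pow_const _).ennreal_ofReal.mul (hcont.comp ha).measurable.enorm
  have hvm : Measurable fun η => ENNReal.ofReal (b η ^ (-α / 2)) * ‖g η‖ₑ :=
    (hbm.pow_const _).ennreal_ofReal.mul g.continuous.measurable.enorm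
  have hleft : ∫⁻ η, ENNReal.ofReal (b η ^ α) * ‖planeFourier f (a η)‖ₑ ^ 2 =
      ENNReal.ofReal |((2 * π) ^ 2)⁻¹| * ∫⁻ v : ℝ × ℝ,
        ENNReal.ofReal ((1 + v.1 ^ 2 + v.2 ^ 2) ^ α) * ‖planeFourier f v‖ₑ ^ 2 := by
    refine lintegral_comp_dilation_translation (h := fun v =>
      ENNReal.ofReal ((1 + v.1 ^ 2 + v.2 ^ 2) ^ α) * ‖planeFourier f v‖ₑ ^ 2) ?_ w
    exact Measurable.mul (by fun_prop) (hcont.measurable.enorm.pow_const 2)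
  have hright : ∫⁻ η, ENNReal.ofReal (b η ^ (-α)) * ‖g η‖ₑ ^ 2 ≤ ENNReal.ofReal (10 ^ (2 * k)) *
      ∫⁻ η, ENNReal.ofReal ((1 + ‖η‖) ^ (2 * k)) * ‖g η‖ₑ ^ 2 := by
    rw [← lintegral_const_mul' _ _ ENNReal.ofReal_ne_top]
    refine lintegral_mono fun η => ?_
    rw [← mul_assoc, ← ENNReal.ofReal_mul (by positivity)]
    gcongr
    exact hweight η
  calc ‖planeFourier f w‖ₑ ^ 2 = ‖∫ η : ℂ, planeFourier f (a η) * g η‖ₑ ^ 2 := by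
        rw [hg f hf hsupp w]
    _ ≤ (∫⁻ η : ℂ, ‖planeFourier f (a η) * g η‖ₑ) ^ 2 :=
        pow_le_pow_left' (enorm_integral_le_lintegral_enorm _) 2
    _ ≤ (∫⁻ η, ENNReal.ofReal (b η ^ α) * ‖planeFourier f (a η)‖ₑ ^ 2) *
          ∫⁻ η, ENNReal.ofReal (b η ^ (-α)) * ‖g η‖ₑ ^ 2 := by
        simp_rw [hsplit]
        refine (sq_lintegral_mul_le hum.aemeasurable hvm.aemeasurable).trans_eq ?_
        simp_rw [mul_pow, hsq]
    _ ≤ _ := by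
        rw [hleft]
        refine (mul_le_mul_right hright _).trans_eq ?_
        ring

lemma lintegral_unitDisc_inv_norm_lt_top :
    ∫⁻ w : ℝ × ℝ, {w : ℝ × ℝ | w.1 ^ 2 + w.2 ^ 2 ≤ 1}.indicator 1 w *
      ENNReal.ofReal (√(w.1 ^ 2 + w.2 ^ 2))⁻¹ < ⊤ := by
  have hm : MeasurableSet {w : ℝ × ℝ | w.1 ^ 2 + w.2 ^ 2 ≤ 1} :=
    measurableSet_le (by fun_prop) (by fun_prop)
  rw [← lintegral_signed_polar (measurable_one.indicator hm)]
  have hind : ∀ q : ℝ × ℝ, {w : ℝ × ℝ | w.1 ^ 2 + w.2 ^ 2 ≤ 1}.indicator (1 : ℝ × ℝ → ENNReal)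
      (q.1 * cos q.2, q.1 * sin q.2) = (Set.Icc (-1) 1 ×ˢ Set.univ).indicator 1 q := fun q => by
    refine Set.indicator_eq_indicator ?_ rfl
    rw [Set.mem_ofPred_eq, show (q.1 * cos q.2) ^ 2 + (q.1 * sin q.2) ^ 2 = q.1 ^ 2 by
      linear_combination q.1 ^ 2 * sin_sq_add_cos_sq q.2, sq_le_one_iff_abs_le_one, abs_le]
    simp
  simp_rw [hind]
  rw [lintegral_indicator_one (measurableSet_Icc.prod MeasurableSet.univ),
    Measure.restrict_apply (measurableSet_Icc.prod MeasurableSet.univ), Set.prod_inter_prod,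
    Set.inter_univ, Set.univ_inter, Measure.volume_eq_prod, Measure.prod_prod]
  simp [ENNReal.mul_lt_top]

lemma rpow_le_rpow_add_half_mul_inv_sqrt {r : ℝ} (hr : 0 < r) (α : ℝ) :
    (1 + r) ^ α ≤ (1 + r) ^ (α + 1 / 2) * (√r)⁻¹ := by
  have h0 : 0 < 1 + r := by positivity
  rw [rpow_add h0, ← sqrt_eq_rpow, mul_assoc]
  refine le_mul_of_one_le_right (rpow_nonneg h0.le _) ?_
  rw [← div_eq_mul_inv, one_le_div (sqrt_pos.mpr hr)]
  exact sqrt_le_sqrt (by linarith)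

lemma rpow_add_half_mul_inv_sqrt_le {r : ℝ} (hr : 1 ≤ r) (α : ℝ) :
    (1 + r) ^ (α + 1 / 2) * (√r)⁻¹ ≤ 2 * (1 + r) ^ α := by
  have h0 : 0 < 1 + r := by positivity
  rw [rpow_add h0, ← sqrt_eq_rpow, mul_assoc, mul_comm]
  refine mul_le_mul_of_nonneg_right ?_ (rpow_nonneg h0.le _)
  rw [← div_eq_mul_inv, div_le_iff₀ (sqrt_pos.mpr (by linarith))]
  rw [sqrt_le_left (by positivity), mul_pow, sq_sqrt (by linarith)]
  linarith

lemma rpow_one_add_le_two_rpow_abs {r : ℝ} (h0 : 0 ≤ r) (h1 : r ≤ 1) (β : ℝ) :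
    (1 + r) ^ β ≤ 2 ^ |β| :=
  (rpow_le_rpow_of_exponent_le (by linarith) (le_abs_self β)).trans
    (rpow_le_rpow (by linarith) (by linarith) (abs_nonneg β))

lemma lintegral_sobolev_le {f : ℝ × ℝ → ℝ} (α : ℝ) :
    ∫⁻ w : ℝ × ℝ, ENNReal.ofReal ((1 + w.1 ^ 2 + w.2 ^ 2) ^ α) * ‖planeFourier f w‖ₑ ^ 2 ≤
      ∫⁻ w : ℝ × ℝ, ENNReal.ofReal ((1 + w.1 ^ 2 + w.2 ^ 2) ^ (α + 1 / 2)) *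
        ‖planeFourier f w‖ₑ ^ 2 * ENNReal.ofReal (√(w.1 ^ 2 + w.2 ^ 2))⁻¹ := by
  have hne : ∀ᵐ w : ℝ × ℝ, w ≠ 0 := Measure.ae_ne volume 0
  refine lintegral_mono_ae ?_
  filter_upwards [hne] with w hw
  have hr : 0 < w.1 ^ 2 + w.2 ^ 2 := by
    by_contra! h
    have h1 : w.1 ^ 2 = 0 := by linarith [sq_nonneg w.1, sq_nonneg w.2]
    have h2 : w.2 ^ 2 = 0 := by linarith [sq_nonneg w.1, sq_nonneg w.2]
    exact hw (Prod.ext (pow_eq_zero_iff two_ne_zero |>.mp h1) (pow_eq_zero_iff two_ne_zero |>.mp h2))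
  rw [mul_right_comm, ← ENNReal.ofReal_mul (rpow_nonneg (by linarith) _), add_assoc]
  gcongr
  exact rpow_le_rpow_add_half_mul_inv_sqrt hr α

lemma exists_lintegral_sobolev_add_half_le {B : Set (ℝ × ℝ)} (hB : Bornology.IsBounded B)
    (α : ℝ) :
    ∃ A : ENNReal, 2 ≤ A ∧ A < ⊤ ∧ ∀ f : ℝ × ℝ → ℝ, Integrable f → Function.support f ⊆ B →
      ∫⁻ w : ℝ × ℝ, ENNReal.ofReal ((1 + w.1 ^ 2 + w.2 ^ 2) ^ (α + 1 / 2)) *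
        ‖planeFourier f w‖ₑ ^ 2 * ENNReal.ofReal (√(w.1 ^ 2 + w.2 ^ 2))⁻¹ ≤
      A * ∫⁻ w : ℝ × ℝ,
        ENNReal.ofReal ((1 + w.1 ^ 2 + w.2 ^ 2) ^ α) * ‖planeFourier f w‖ₑ ^ 2 := by
  obtain ⟨K, hK, hKf⟩ := exists_enorm_planeFourier_sq_le hB α
  set V := ∫⁻ w : ℝ × ℝ, {w : ℝ × ℝ | w.1 ^ 2 + w.2 ^ 2 ≤ 1}.indicator 1 w *
      ENNReal.ofReal (√(w.1 ^ 2 + w.2 ^ 2))⁻¹ with hV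
  have hVt : V < ⊤ := lintegral_unitDisc_inv_norm_lt_top
  set P := ENNReal.ofReal (2 ^ |α + 1 / 2|) with hP
  refine ⟨2 + P * K * V, le_self_add, ?_, fun f hf hsupp => ?_⟩
  · exact ENNReal.add_lt_top.mpr ⟨ENNReal.ofNat_lt_top,
      ENNReal.mul_lt_top (ENNReal.mul_lt_top ENNReal.ofReal_lt_top hK) hVt⟩
  set N := ∫⁻ w : ℝ × ℝ,
    ENNReal.ofReal ((1 + w.1 ^ 2 + w.2 ^ 2) ^ α) * ‖planeFourier f w‖ₑ ^ 2 with hN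
  have hm : MeasurableSet {w : ℝ × ℝ | w.1 ^ 2 + w.2 ^ 2 ≤ 1} :=
    measurableSet_le (by fun_prop) (by fun_prop)
  have hF := (continuous_planeFourier hf).measurable
  have hpt : ∀ w : ℝ × ℝ, ENNReal.ofReal ((1 + w.1 ^ 2 + w.2 ^ 2) ^ (α + 1 / 2)) *
        ‖planeFourier f w‖ₑ ^ 2 * ENNReal.ofReal (√(w.1 ^ 2 + w.2 ^ 2))⁻¹ ≤
      2 * (ENNReal.ofReal ((1 + w.1 ^ 2 + w.2 ^ 2) ^ α) * ‖planeFourier f w‖ₑ ^ 2) +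
      P * K * N * ({w : ℝ × ℝ | w.1 ^ 2 + w.2 ^ 2 ≤ 1}.indicator 1 w *
        ENNReal.ofReal (√(w.1 ^ 2 + w.2 ^ 2))⁻¹) := fun w => by
    have hr : 0 ≤ w.1 ^ 2 + w.2 ^ 2 := by positivity
    rw [add_assoc 1]
    by_cases hw : w.1 ^ 2 + w.2 ^ 2 ≤ 1
    · refine le_add_left ?_
      rw [Set.indicator_of_mem (by exact hw), Pi.one_apply, one_mul, mul_assoc P]
      gcongr
      · exact ENNReal.ofReal_le_ofReal <| rpow_one_add_le_two_rpow_abs hr hw _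
      · exact hKf f hf hsupp w hw
    · refine le_add_right ?_
      rw [mul_right_comm, ← ENNReal.ofReal_mul (rpow_nonneg (by linarith) _), ← mul_assoc,
        ← ENNReal.ofReal_ofNat 2, ← ENNReal.ofReal_mul zero_le_two]
      refine mul_le_mul_left (ENNReal.ofReal_le_ofReal ?_) _
      exact rpow_add_half_mul_inv_sqrt_le (not_le.mp hw).le α
  refine (lintegral_mono hpt).trans_eq ?_
  rw [lintegral_add_left, lintegral_const_mul, lintegral_const_mul, ← hN, ← hV]
  · ring
  · exact (measurable_one.indicator hm).mul (by fun_prop)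
  · exact Measurable.mul (by fun_prop) (hF.enorm.pow_const 2)
  · exact (Measurable.mul (by fun_prop) (hF.enorm.pow_const 2)).const_mul _

lemma ofReal_mul_norm_sq {a : ℝ} (ha : 0 ≤ a) (z : ℂ) :
    ENNReal.ofReal (a * ‖z‖ ^ 2) = ENNReal.ofReal a * ‖z‖ₑ ^ 2 := by
  rw [ENNReal.ofReal_mul ha, ENNReal.ofReal_pow (norm_nonneg z), ofReal_norm]

/-- Sobolev continuity of the Radon transform: for `Ω ⊂ ℝ²` open and bounded and `α ∈ ℝ`,
there is a constant `C_α > 1` such that every `f ∈ L¹(ℝ²) ∩ H₀^α(Ω)` has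
`Rf ∈ H^{α+1/2}(ℝ × [0,π))` with
`‖f‖_{H^α(ℝ²)} ≤ ‖Rf‖_{H^{α+1/2}(ℝ × [0,π))} ≤ C_α·‖f‖_{H^α(ℝ²)}`, the Sobolev norms being
defined via the (1D resp. 2D) Fourier transform. -/
theorem statement14 (Ω : Set (ℝ × ℝ)) (hΩo : IsOpen Ω) (hΩb : Bornology.IsBounded Ω)
    (α : ℝ) :
    ∃ C : ℝ, 1 < C ∧
      ∀ f : ℝ × ℝ → ℝ, Integrable f → Function.support f ⊆ closure Ω →
        Integrable (fun w : ℝ × ℝ =>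
          Real.rpow (1 + w.1 ^ 2 + w.2 ^ 2) α *
            ‖∫ p : ℝ × ℝ, (f p : ℂ) * Complex.exp (-Complex.I * (p.1 * w.1 + p.2 * w.2))‖ ^ 2) →
        IntegrableOn (fun q : ℝ × ℝ =>
            Real.rpow (1 + q.1 ^ 2) (α + 1 / 2) *
              ‖∫ t : ℝ,
                  (↑(∫ s : ℝ, f (t * Real.cos q.2 - s * Real.sin q.2,
                      t * Real.sin q.2 + s * Real.cos q.2)) : ℂ) *
                    Complex.exp (-Complex.I * (q.1 * t))‖ ^ 2)
          (Set.univ ×ˢ Set.Ico 0 Real.pi) ∧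
        Real.sqrt (∫ w : ℝ × ℝ,
            Real.rpow (1 + w.1 ^ 2 + w.2 ^ 2) α *
              ‖∫ p : ℝ × ℝ, (f p : ℂ) * Complex.exp (-Complex.I * (p.1 * w.1 + p.2 * w.2))‖ ^ 2) ≤
          Real.sqrt (∫ q in Set.univ ×ˢ Set.Ico 0 Real.pi,
            Real.rpow (1 + q.1 ^ 2) (α + 1 / 2) *
              ‖∫ t : ℝ,
                  (↑(∫ s : ℝ, f (t * Real.cos q.2 - s * Real.sin q.2,
                      t * Real.sin q.2 + s * Real.cos q.2)) : ℂ) *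
                    Complex.exp (-Complex.I * (q.1 * t))‖ ^ 2) ∧
        Real.sqrt (∫ q in Set.univ ×ˢ Set.Ico 0 Real.pi,
            Real.rpow (1 + q.1 ^ 2) (α + 1 / 2) *
              ‖∫ t : ℝ,
                  (↑(∫ s : ℝ, f (t * Real.cos q.2 - s * Real.sin q.2,
                      t * Real.sin q.2 + s * Real.cos q.2)) : ℂ) *
                    Complex.exp (-Complex.I * (q.1 * t))‖ ^ 2) ≤
          C * Real.sqrt (∫ w : ℝ × ℝ,
            Real.rpow (1 + w.1 ^ 2 + w.2 ^ 2) α *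
              ‖∫ p : ℝ × ℝ, (f p : ℂ) * Complex.exp (-Complex.I * (p.1 * w.1 + p.2 * w.2))‖ ^ 2) := by
  obtain ⟨A, hA2, hAt, hA⟩ := exists_lintegral_sobolev_add_half_le hΩb.closure α
  have hAr : 2 ≤ A.toReal := by
    simpa using ENNReal.toReal_mono hAt.ne hA2
  refine ⟨√A.toReal, lt_sqrt_of_sq_lt (by linarith), fun f hf hsupp hfα => ?_⟩
  simp_rw [fourier_radon_eq_planeFourier hf]
  change Integrable (fun w : ℝ × ℝ =>
    (1 + w.1 ^ 2 + w.2 ^ 2) ^ α * ‖planeFourier f w‖ ^ 2) at hfα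
  change IntegrableOn (fun q : ℝ × ℝ => (1 + q.1 ^ 2) ^ (α + 1 / 2) *
      ‖planeFourier f (q.1 * cos q.2, q.1 * sin q.2)‖ ^ 2) (Set.univ ×ˢ Set.Ico 0 π) ∧
    √(∫ w : ℝ × ℝ, (1 + w.1 ^ 2 + w.2 ^ 2) ^ α * ‖planeFourier f w‖ ^ 2) ≤
      √(∫ q in Set.univ ×ˢ Set.Ico 0 π, (1 + q.1 ^ 2) ^ (α + 1 / 2) *
        ‖planeFourier f (q.1 * cos q.2, q.1 * sin q.2)‖ ^ 2) ∧
    √(∫ q in Set.univ ×ˢ Set.Ico 0 π, (1 + q.1 ^ 2) ^ (α + 1 / 2) *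
        ‖planeFourier f (q.1 * cos q.2, q.1 * sin q.2)‖ ^ 2) ≤
      √A.toReal * √(∫ w : ℝ × ℝ, (1 + w.1 ^ 2 + w.2 ^ 2) ^ α * ‖planeFourier f w‖ ^ 2)
  have hF := (continuous_planeFourier hf).measurable
  have hw0 : ∀ (w : ℝ × ℝ) (β : ℝ), 0 ≤ (1 + w.1 ^ 2 + w.2 ^ 2) ^ β :=
    fun w β => rpow_nonneg (by positivity) β
  have hq0 : ∀ (q : ℝ × ℝ) (β : ℝ), 0 ≤ (1 + q.1 ^ 2) ^ β :=
    fun q β => rpow_nonneg (by positivity) β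
  have hN0 : 0 ≤ᵐ[volume] fun w : ℝ × ℝ =>
      (1 + w.1 ^ 2 + w.2 ^ 2) ^ α * ‖planeFourier f w‖ ^ 2 :=
    Filter.Eventually.of_forall fun w => mul_nonneg (hw0 w α) (sq_nonneg _)
  have hM0 : 0 ≤ᵐ[volume.restrict (Set.univ ×ˢ Set.Ico 0 π)] fun q : ℝ × ℝ =>
      (1 + q.1 ^ 2) ^ (α + 1 / 2) * ‖planeFourier f (q.1 * cos q.2, q.1 * sin q.2)‖ ^ 2 :=
    Filter.Eventually.of_forall fun q => mul_nonneg (hq0 q _) (sq_nonneg _)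
  have hMm : Measurable fun q : ℝ × ℝ =>
      (1 + q.1 ^ 2) ^ (α + 1 / 2) * ‖planeFourier f (q.1 * cos q.2, q.1 * sin q.2)‖ ^ 2 :=
    Measurable.mul (by fun_prop) ((hF.comp (by fun_prop)).norm.pow_const 2)
  have hpolar : ∫⁻ q in Set.univ ×ˢ Set.Ico 0 π, ENNReal.ofReal ((1 + q.1 ^ 2) ^ (α + 1 / 2) *
        ‖planeFourier f (q.1 * cos q.2, q.1 * sin q.2)‖ ^ 2) =
      ∫⁻ w : ℝ × ℝ, ENNReal.ofReal ((1 + w.1 ^ 2 + w.2 ^ 2) ^ (α + 1 / 2)) *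
        ‖planeFourier f w‖ₑ ^ 2 * ENNReal.ofReal (√(w.1 ^ 2 + w.2 ^ 2))⁻¹ := by
    rw [← lintegral_signed_polar (h := fun w =>
      ENNReal.ofReal ((1 + w.1 ^ 2 + w.2 ^ 2) ^ (α + 1 / 2)) * ‖planeFourier f w‖ₑ ^ 2)
      (Measurable.mul (by fun_prop) (hF.enorm.pow_const 2))]
    refine lintegral_congr fun q => ?_
    rw [ofReal_mul_norm_sq (hq0 q _), show 1 + (q.1 * cos q.2) ^ 2 + (q.1 * sin q.2) ^ 2 =
      1 + q.1 ^ 2 by linear_combination q.1 ^ 2 * sin_sq_add_cos_sq q.2]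
  have hNe : ∫⁻ w : ℝ × ℝ,
        ENNReal.ofReal ((1 + w.1 ^ 2 + w.2 ^ 2) ^ α * ‖planeFourier f w‖ ^ 2) =
      ∫⁻ w : ℝ × ℝ, ENNReal.ofReal ((1 + w.1 ^ 2 + w.2 ^ 2) ^ α) * ‖planeFourier f w‖ₑ ^ 2 :=
    lintegral_congr fun w => ofReal_mul_norm_sq (hw0 w α) _
  have hlower := lintegral_sobolev_le (f := f) α
  have hupper := hA f hf hsupp
  rw [← hpolar, ← hNe] at hlower hupper
  have hNt := (lintegral_ofReal_ne_top_iff_integrable hfα.aestronglyMeasurable hN0).mpr hfα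
  have hMt := ne_top_of_le_ne_top (ENNReal.mul_ne_top hAt.ne hNt) hupper
  refine ⟨(lintegral_ofReal_ne_top_iff_integrable hMm.aestronglyMeasurable hM0).mp hMt, ?_, ?_⟩
  · refine sqrt_le_sqrt ?_
    rw [integral_eq_lintegral_of_nonneg_ae hN0 hfα.aestronglyMeasurable,
      integral_eq_lintegral_of_nonneg_ae hM0 hMm.aestronglyMeasurable]
    exact ENNReal.toReal_mono hMt hlower
  · rw [← sqrt_mul ENNReal.toReal_nonneg]
    refine sqrt_le_sqrt ?_
    rw [integral_eq_lintegral_of_nonneg_ae hN0 hfα.aestronglyMeasurable,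
      integral_eq_lintegral_of_nonneg_ae hM0 hMm.aestronglyMeasurable, ← ENNReal.toReal_mul]
    exact ENNReal.toReal_mono (ENNReal.mul_ne_top hAt.ne hNt) hupper
end
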